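/- arXiv:2207.13416 — 3 statements merged into one kernel-verified Lean document; each statement's English description precedes it below -/
import Mathlib

section
/- Let V be a finite type, E : V → V → Prop, w : V → V → ℝ, and I, F : Set V. Call an infinite E-path f : ℕ → V accepting if f 0 ∈ I and the set {n : f n ∈ F} is infinite, and define its Sup-payoff as the supremum over i : ℕ of w (f i) (f (i+1)). If there exists an accepting infinite E-path, then there exists an accepting infinite E-path f* that is eventually periodic and whose Sup-payoff is less than or equal to the Sup-payoff of every accepting infinite E-path (i.e., the infimum of Sup-payoffs over accepting paths is attained by a lasso). -/
/-- Every infinite path visiting `F` infinitely often can be turned into an eventually periodic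
path with the same starting point that only uses steps of the original path. -/
theorem exists_eventually_periodic_of_infinite_visits {V : Type*} [Finite V] {F : Set V}
    (g : ℕ → V) (hg : {n : ℕ | g n ∈ F}.Infinite) :
    ∃ f : ℕ → V, (∀ i, ∃ j, f i = g j ∧ f (i + 1) = g (j + 1)) ∧ f 0 = g 0 ∧
      {n : ℕ | f n ∈ F}.Infinite ∧
      ∃ N p : ℕ, 1 ≤ p ∧ ∀ i, N ≤ i → f (i + p) = f i := by
  obtain ⟨a, ha, b, -, hab, heq⟩ : ∃ a ∈ {n : ℕ | g n ∈ F}, ∃ b ∈ {n : ℕ | g n ∈ F},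
      a < b ∧ g a = g b :=
    hg.exists_lt_map_eq_of_mapsTo (t := Set.univ) (fun _ _ => Set.mem_univ _) Set.finite_univ
  obtain ⟨p, rfl⟩ := Nat.exists_eq_add_of_lt hab
  refine ⟨fun i => if i < a then g i else g (a + (i - a) % (p + 1)), fun i => ?_, ?_, ?_,
    a, p + 1, by omega, fun i hi => ?_⟩
  · rcases lt_or_ge i a with hi | hi
    · refine ⟨i, by simp [hi], ?_⟩
      rcases Nat.lt_or_ge (i + 1) a with h | h
      · simp [h]
      · obtain rfl : a = i + 1 := by omega
        simp
    · refine ⟨a + (i - a) % (p + 1), by simp [hi.not_gt], ?_⟩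
      have hlt := Nat.mod_lt (i - a) (Nat.add_one_pos p)
      beta_reduce
      rw [if_neg (by omega), show i + 1 - a = i - a + 1 by omega, Nat.add_mod_eq_ite]
      rcases Nat.eq_zero_or_pos p with rfl | hp
      · simpa [Nat.mod_one] using heq
      · rw [Nat.mod_eq_of_lt (show 1 < p + 1 by omega)]
        split_ifs with h
        · rw [show (i - a) % (p + 1) = p by omega]
          simpa [add_assoc] using heq
        · rfl
  · rcases Nat.eq_zero_or_pos a with rfl | h
    · simp
    · simp [h]
  · refine Set.infinite_of_injective_forall_mem (f := fun n => a + (p + 1) * n) ?_ fun n => ?_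
    · intro m n h
      simpa using h
    · simpa using ha
  · simp [hi.not_gt, show ¬ i + (p + 1) < a by omega,
      show i + (p + 1) - a = i - a + (p + 1) by omega]

theorem sup_payoff_inf_attained_by_lasso
    {V : Type*} [Fintype V]
    (E : V → V → Prop) (w : V → V → ℝ) (I F : Set V)
    (hex : ∃ f : ℕ → V, (∀ i, E (f i) (f (i + 1))) ∧ f 0 ∈ I ∧
      {n : ℕ | f n ∈ F}.Infinite) :
    ∃ f : ℕ → V, (∀ i, E (f i) (f (i + 1))) ∧ f 0 ∈ I ∧
      {n : ℕ | f n ∈ F}.Infinite ∧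
      (∃ N p : ℕ, 1 ≤ p ∧ ∀ i, N ≤ i → f (i + p) = f i) ∧
      ∀ g : ℕ → V, (∀ i, E (g i) (g (i + 1))) → g 0 ∈ I →
        {n : ℕ | g n ∈ F}.Infinite →
        (⨆ i : ℕ, w (f i) (f (i + 1))) ≤ ⨆ i : ℕ, w (g i) (g (i + 1)) := by
  have hsteps (g : ℕ → V) : Set.range (fun i => w (g i) (g (i + 1))) ⊆
      Set.range (fun e : V × V => w e.1 e.2) := by
    rintro _ ⟨i, rfl⟩
    exact ⟨(g i, g (i + 1)), rfl⟩
  have hfin (g : ℕ → V) : (Set.range (fun i => w (g i) (g (i + 1)))).Finite :=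
    (Set.finite_range _).subset (hsteps g)
  let S : Set (ℕ → V) := {f | (∀ i, E (f i) (f (i + 1))) ∧ f 0 ∈ I ∧ {n : ℕ | f n ∈ F}.Infinite}
  have hpayoffs : ((fun g : ℕ → V => ⨆ i : ℕ, w (g i) (g (i + 1))) '' S).Finite := by
    refine (Set.finite_range (fun e : V × V => w e.1 e.2)).subset ?_
    rintro _ ⟨g, -, rfl⟩
    exact hsteps g ((Set.range_nonempty _).csSup_mem (hfin g))
  obtain ⟨_, ⟨g, ⟨hgE, hgI, hgF⟩, rfl⟩, hmin⟩ :=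
    Set.exists_min_image _ id hpayoffs (Set.Nonempty.image _ hex)
  obtain ⟨f, hf, hf0, hfF, hper⟩ := exists_eventually_periodic_of_infinite_visits g hgF
  refine ⟨f, fun i => ?_, hf0 ▸ hgI, hfF, hper, fun h hE hI hF =>
    le_trans (ciSup_le fun i => ?_) (hmin _ ⟨h, ⟨hE, hI, hF⟩, rfl⟩)⟩
  · obtain ⟨j, h₁, h₂⟩ := hf i
    rw [h₁, h₂]
    exact hgE j
  · obtain ⟨j, h₁, h₂⟩ := hf i
    rw [h₁, h₂]
    exact le_ciSup (f := fun i => w (g i) (g (i + 1))) (hfin g).bddAbove j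
end

section
/- Let V be a finite type, E : V → V → Prop, w : V → V → ℝ, and I, F : Set V. Call an infinite E-path f : ℕ → V accepting if f 0 ∈ I and the set {n : f n ∈ F} is infinite, and define its LimSup-payoff as limsup_{i→∞} w (f i) (f (i+1)). If there exists an accepting infinite E-path, then there exists an accepting infinite E-path f* that is eventually periodic and whose LimSup-payoff is less than or equal to the LimSup-payoff of every accepting infinite E-path (i.e., the infimum of LimSup-payoffs over accepting paths is attained by a lasso). -/
/-- The time reparametrization that follows `0, 1, …, n - 1` and then repeats `m, …, n - 1`. -/
def lassoIndex (m n i : ℕ) : ℕ := if i < m then i else m + (i - m) % (n - m)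

theorem lassoIndex_zero (m n : ℕ) : lassoIndex m n 0 = 0 := by
  rcases Nat.eq_zero_or_pos m with rfl | h <;> simp [lassoIndex, *]

theorem le_lassoIndex {m i : ℕ} (n : ℕ) (h : m ≤ i) : m ≤ lassoIndex m n i := by
  simp [lassoIndex, h.not_gt]

theorem lassoIndex_add_period {m n i : ℕ} (h : m ≤ i) :
    lassoIndex m n (i + (n - m)) = lassoIndex m n i := by
  have h' : ¬ i + (n - m) < m := by omega
  have e : i + (n - m) - m = (i - m) + (n - m) := by omega
  simp [lassoIndex, h.not_gt, h', e]

theorem lassoIndex_add_mul_period (m n k : ℕ) : lassoIndex m n (m + k * (n - m)) = m := by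
  simp [lassoIndex]

theorem apply_lassoIndex_succ {V : Type*} {g : ℕ → V} {m n : ℕ} (hmn : m < n) (hg : g m = g n)
    (i : ℕ) : g (lassoIndex m n (i + 1)) = g (lassoIndex m n i + 1) := by
  unfold lassoIndex
  rcases lt_trichotomy (i + 1) m with h | h | h
  · rw [if_pos h, if_pos (by omega)]
  · rw [if_neg (by omega), if_pos (by omega)]
    simp [h]
  · have hi : i + 1 - m = i - m + 1 := by omega
    have hlt := Nat.mod_lt (i - m) (Nat.sub_pos_of_lt hmn)
    rw [if_neg (by omega), if_neg (by omega), hi, Nat.add_mod_eq_ite]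
    rcases Nat.eq_or_lt_of_le (Nat.succ_le_of_lt (Nat.sub_pos_of_lt hmn)) with h1 | h1
    · have h0 : (i - m) % (n - m) = 0 := by omega
      have hn : n = m + 1 := by omega
      subst hn
      simpa [Nat.mod_one] using hg
    · rw [Nat.mod_eq_of_lt h1]
      split_ifs with hc
      · have e : m + (i - m) % (n - m) + 1 = n := by omega
        have e' : m + ((i - m) % (n - m) + 1 - (n - m)) = m := by omega
        rw [e, e', hg]
      · rfl

/-- A sequence drawn from a finite family of reals is eventually bounded by a member of the family
that does not exceed its limit superior. -/
theorem exists_eventually_le_and_le_limsup {ι : Type*} [Finite ι] (w : ι → ℝ) (u : ℕ → ι) :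
    ∃ x, (∀ᶠ i in Filter.atTop, w (u i) ≤ w x) ∧
      w x ≤ Filter.limsup (fun i => w (u i)) Filter.atTop := by
  set L := Filter.limsup (fun i => w (u i)) Filter.atTop with hL
  have hbdd : Filter.IsBoundedUnder (· ≤ ·) Filter.atTop (fun i => w (u i)) :=
    ((Set.finite_range w).bddAbove.mono (Set.range_comp_subset_range u w)).isBoundedUnder_of_range
  have hev : ∀ᶠ i in Filter.atTop, w (u i) ≤ L := by
    have hall : ∀ᶠ i in Filter.atTop, ∀ x, L < w x → w (u i) < w x := by
      refine Filter.eventually_all.2 fun x => ?_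
      by_cases hx : L < w x
      · exact (Filter.eventually_lt_of_limsup_lt hx hbdd).mono fun i hi _ => hi
      · exact Filter.Eventually.of_forall fun i h => absurd h hx
    filter_upwards [hall] with i hi
    by_contra! h
    exact lt_irrefl _ (hi _ h)
  obtain ⟨j, hj⟩ := hev.exists
  obtain ⟨x, hx, hmax⟩ :=
    Set.exists_max_image {x | w x ≤ L} w (Set.toFinite _) ⟨u j, hj⟩
  exact ⟨x, hev.mono fun i hi => hmax _ hi, hx⟩

theorem limsup_le_of_eventually_le_of_finite {ι : Type*} [Finite ι] (w : ι → ℝ) (u : ℕ → ι) {c : ℝ}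
    (h : ∀ᶠ i in Filter.atTop, w (u i) ≤ c) :
    Filter.limsup (fun i => w (u i)) Filter.atTop ≤ c := by
  have hbdd : Filter.IsBoundedUnder (· ≥ ·) Filter.atTop (fun i => w (u i)) :=
    ((Set.finite_range w).bddBelow.mono (Set.range_comp_subset_range u w)).isBoundedUnder_of_range
  exact Filter.limsup_le_of_le hbdd.isCoboundedUnder_le h

theorem limsup_payoff_inf_attained_by_lasso
    {V : Type*} [Fintype V]
    (E : V → V → Prop) (w : V → V → ℝ) (I F : Set V)
    (hex : ∃ f : ℕ → V, (∀ i, E (f i) (f (i + 1))) ∧ f 0 ∈ I ∧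
      {n : ℕ | f n ∈ F}.Infinite) :
    ∃ f : ℕ → V, (∀ i, E (f i) (f (i + 1))) ∧ f 0 ∈ I ∧
      {n : ℕ | f n ∈ F}.Infinite ∧
      (∃ N p : ℕ, 1 ≤ p ∧ ∀ i, N ≤ i → f (i + p) = f i) ∧
      ∀ g : ℕ → V, (∀ i, E (g i) (g (i + 1))) → g 0 ∈ I →
        {n : ℕ | g n ∈ F}.Infinite →
        Filter.limsup (fun i : ℕ => w (f i) (f (i + 1))) Filter.atTop ≤
          Filter.limsup (fun i : ℕ => w (g i) (g (i + 1))) Filter.atTop := by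
  let W : V × V → ℝ := fun x => w x.1 x.2
  let T : Set (V × V) := {x | ∃ g : ℕ → V, (∀ i, E (g i) (g (i + 1))) ∧ g 0 ∈ I ∧
    {n : ℕ | g n ∈ F}.Infinite ∧ ∀ᶠ i in Filter.atTop, w (g i) (g (i + 1)) ≤ W x}
  have hT : T.Nonempty := by
    obtain ⟨g, hE, hI, hF⟩ := hex
    obtain ⟨x, hx, -⟩ := exists_eventually_le_and_le_limsup W fun i => (g i, g (i + 1))
    exact ⟨x, g, hE, hI, hF, hx⟩
  obtain ⟨x, ⟨g, hE, hI, hF, hev⟩, hmin⟩ := Set.exists_min_image T W (Set.toFinite T) hT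
  obtain ⟨N, hN⟩ := Filter.eventually_atTop.1 hev
  have hinf : ({n : ℕ | g n ∈ F} \ Set.Iio N).Infinite := hF.sdiff (Set.finite_Iio N)
  obtain ⟨m, ⟨hmF, hmN⟩, n, -, hmn, hg⟩ :=
    hinf.exists_lt_map_eq_of_mapsTo (Set.mapsTo_univ g _) Set.finite_univ
  have hm : N ≤ m := not_lt.1 hmN
  have hsucc := apply_lassoIndex_succ hmn hg
  refine ⟨fun i => g (lassoIndex m n i), fun i => ?_, ?_, ?_, ⟨m, n - m, ?_, fun i hi => ?_⟩, ?_⟩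
  · simpa only [hsucc] using hE (lassoIndex m n i)
  · simpa only [lassoIndex_zero] using hI
  · refine Set.infinite_of_injective_forall_mem (f := fun k => m + k * (n - m)) ?_ fun k => ?_
    · intro a b hab
      exact Nat.eq_of_mul_eq_mul_right (Nat.sub_pos_of_lt hmn) (Nat.add_left_cancel hab)
    · simpa only [Set.mem_ofPred_eq, lassoIndex_add_mul_period] using hmF
  · exact Nat.sub_pos_of_lt hmn
  · simp only [lassoIndex_add_period hi]
  · intro g' hE' hI' hF'
    obtain ⟨y, hy, hyL⟩ := exists_eventually_le_and_le_limsup W fun i => (g' i, g' (i + 1))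
    refine le_trans ?_ ((hmin y ⟨g', hE', hI', hF', hy⟩).trans hyL)
    refine limsup_le_of_eventually_le_of_finite W
      (fun i => (g (lassoIndex m n i), g (lassoIndex m n (i + 1)))) ?_
    filter_upwards [Filter.eventually_ge_atTop m] with i hi
    simpa only [W, hsucc] using hN _ (hm.trans (le_lassoIndex n hi))
end

section
/- Let V be a finite type, E : V → V → Prop, w : V → V → ℝ with w u v ≥ 0 for all u v, λ a real with 0 ≤ λ < 1, and F : Set V. For an infinite E-path f, define its DSum-payoff as ∑_{i=0}^∞ λ^i · w (f i) (f (i+1)). Suppose that from every vertex v ∈ V there exists an infinite E-path g with g 0 = v and {n : g n ∈ F} infinite. Then for every v₀ ∈ V and every ε > 0, there exists an infinite E-path f with f 0 = v₀ and {n : f n ∈ F} infinite whose DSum-payoff is at most (the infimum of DSum-payoffs over all infinite E-paths starting at v₀) + ε. -/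
/-- The sequence that follows `g` for `N` steps and then continues with `h`. -/
def splice {V : Type*} (g : ℕ → V) (N : ℕ) (h : ℕ → V) (i : ℕ) : V :=
  if i < N then g i else h (i - N)

section Splice

variable {V : Type*} {g h : ℕ → V} {N : ℕ}

theorem splice_of_le (hgh : h 0 = g N) {i : ℕ} (hi : i ≤ N) : splice g N h i = g i := by
  rcases hi.lt_or_eq with hi | rfl
  · simp [splice, hi]
  · simp [splice, hgh]

theorem splice_add (i : ℕ) : splice g N h (i + N) = h i := by
  simp [splice]

theorem splice_rel {E : V → V → Prop} (hgh : h 0 = g N) (hg : ∀ i, E (g i) (g (i + 1)))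
    (hh : ∀ i, E (h i) (h (i + 1))) (i : ℕ) : E (splice g N h i) (splice g N h (i + 1)) := by
  rcases lt_or_ge i N with hi | hi
  · rw [splice_of_le hgh hi.le, splice_of_le hgh hi]
    exact hg i
  · obtain ⟨k, rfl⟩ := Nat.exists_eq_add_of_le' hi
    rw [add_right_comm, splice_add, splice_add]
    exact hh k

theorem splice_infinite {F : Set V} (hh : {n | h n ∈ F}.Infinite) :
    {n | splice g N h n ∈ F}.Infinite := by
  refine (hh.image (add_left_injective N).injOn).mono ?_
  rintro _ ⟨n, hn, rfl⟩
  simpa [splice_add] using hn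

end Splice

section DiscountedSum

variable {lam C : ℝ} {a b : ℕ → ℝ}

theorem summable_pow_mul_of_bounded (hlam0 : 0 ≤ lam) (hlam1 : lam < 1)
    (ha0 : ∀ i, 0 ≤ a i) (haC : ∀ i, a i ≤ C) : Summable fun i => lam ^ i * a i :=
  .of_nonneg_of_le (fun i => mul_nonneg (pow_nonneg hlam0 i) (ha0 i))
    (fun i => mul_le_mul_of_nonneg_left (haC i) (pow_nonneg hlam0 i))
    ((summable_geometric_of_lt_one hlam0 hlam1).mul_right C)

theorem tsum_pow_mul_le_of_bounded (hlam0 : 0 ≤ lam) (hlam1 : lam < 1)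
    (ha0 : ∀ i, 0 ≤ a i) (haC : ∀ i, a i ≤ C) :
    ∑' i, lam ^ i * a i ≤ (1 - lam)⁻¹ * C := by
  rw [← tsum_geometric_of_lt_one hlam0 hlam1, ← tsum_mul_right]
  exact (summable_pow_mul_of_bounded hlam0 hlam1 ha0 haC).tsum_le_tsum
    (fun i => mul_le_mul_of_nonneg_left (haC i) (pow_nonneg hlam0 i))
    ((summable_geometric_of_lt_one hlam0 hlam1).mul_right C)

/-- Discounted sums of bounded nonnegative sequences agreeing on the first `N` terms differ by at
most the discounted bound on the tail. -/
theorem tsum_pow_mul_le_of_eq_of_lt (hlam0 : 0 ≤ lam) (hlam1 : lam < 1)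
    (ha0 : ∀ i, 0 ≤ a i) (haC : ∀ i, a i ≤ C) (hb0 : ∀ i, 0 ≤ b i) (hbC : ∀ i, b i ≤ C)
    {N : ℕ} (hab : ∀ i < N, a i = b i) :
    ∑' i, lam ^ i * a i ≤ ∑' i, lam ^ i * b i + lam ^ N * ((1 - lam)⁻¹ * C) := by
  rw [← (summable_pow_mul_of_bounded hlam0 hlam1 ha0 haC).sum_add_tsum_nat_add N]
  refine add_le_add ?_ ?_
  · rw [Finset.sum_congr rfl fun i hi => by rw [hab i (Finset.mem_range.1 hi)]]
    exact (summable_pow_mul_of_bounded hlam0 hlam1 hb0 hbC).sum_le_tsum _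
      fun i _ => mul_nonneg (pow_nonneg hlam0 i) (hb0 i)
  · calc ∑' i, lam ^ (i + N) * a (i + N) = lam ^ N * ∑' i, lam ^ i * a (i + N) := by
          rw [← tsum_mul_left]
          exact tsum_congr fun i => by ring
      _ ≤ lam ^ N * ((1 - lam)⁻¹ * C) :=
          mul_le_mul_of_nonneg_left
            (tsum_pow_mul_le_of_bounded hlam0 hlam1 (fun i => ha0 _) (fun i => haC _))
            (pow_nonneg hlam0 N)

end DiscountedSum

theorem dsum_eps_optimal_accepting_path
    {V : Type*} [Fintype V]
    (E : V → V → Prop) (w : V → V → ℝ) (hw : ∀ u v, 0 ≤ w u v)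
    (lam : ℝ) (hlam0 : 0 ≤ lam) (hlam1 : lam < 1)
    (F : Set V)
    (hacc : ∀ v : V, ∃ g : ℕ → V, g 0 = v ∧ (∀ i, E (g i) (g (i + 1))) ∧
      {n : ℕ | g n ∈ F}.Infinite) :
    ∀ v₀ : V, ∀ ε : ℝ, 0 < ε →
      ∃ f : ℕ → V, f 0 = v₀ ∧ (∀ i, E (f i) (f (i + 1))) ∧
        {n : ℕ | f n ∈ F}.Infinite ∧
        (∑' i : ℕ, lam ^ i * w (f i) (f (i + 1))) ≤
          sInf {x : ℝ | ∃ g : ℕ → V, g 0 = v₀ ∧ (∀ i, E (g i) (g (i + 1))) ∧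
            x = ∑' i : ℕ, lam ^ i * w (g i) (g (i + 1))} + ε := by
  intro v₀ ε hε
  obtain ⟨C, hC⟩ : ∃ C, ∀ u v, w u v ≤ C := by
    obtain ⟨C, hC⟩ := (Set.finite_range fun p : V × V => w p.1 p.2).bddAbove
    exact ⟨C, fun u v => hC ⟨(u, v), rfl⟩⟩
  obtain ⟨N, hN⟩ : ∃ N : ℕ, lam ^ N * ((1 - lam)⁻¹ * C) < ε / 2 := by
    have hlim := (tendsto_pow_atTop_nhds_zero_of_lt_one hlam0 hlam1).mul_const ((1 - lam)⁻¹ * C)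
    rw [zero_mul] at hlim
    exact (hlim.eventually_lt_const (half_pos hε)).exists
  set S := {x : ℝ | ∃ g : ℕ → V, g 0 = v₀ ∧ (∀ i, E (g i) (g (i + 1))) ∧
    x = ∑' i : ℕ, lam ^ i * w (g i) (g (i + 1))}
  have hS : S.Nonempty := by
    obtain ⟨g, hg0, hgE, -⟩ := hacc v₀
    exact ⟨_, g, hg0, hgE, rfl⟩
  obtain ⟨_, ⟨g, hg0, hgE, rfl⟩, hg⟩ :=
    exists_lt_of_csInf_lt hS (lt_add_of_pos_right (sInf S) (half_pos hε))
  obtain ⟨h, hh0, hhE, hhF⟩ := hacc (g N)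
  refine ⟨splice g N h, by rw [splice_of_le hh0 N.zero_le, hg0], splice_rel hh0 hgE hhE,
    splice_infinite hhF, ?_⟩
  have hle := tsum_pow_mul_le_of_eq_of_lt (N := N) hlam0 hlam1
    (a := fun i => w (splice g N h i) (splice g N h (i + 1)))
    (b := fun i => w (g i) (g (i + 1)))
    (fun _ => hw _ _) (fun _ => hC _ _) (fun _ => hw _ _) (fun _ => hC _ _)
    fun i hi => by simp only [splice_of_le hh0 hi.le, splice_of_le hh0 (Nat.succ_le_of_lt hi)]
  linarith
end
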